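/- arXiv:0805.2425 — 2 statements merged into one kernel-verified Lean document; each statement's English description precedes it below -/
import Mathlib

section
/- Let A, B, C be natural numbers, χ an integer, and (e_i)_{i∈ℕ} a finitely supported family of natural numbers with e_0 = e_1 = e_2 = 0, satisfying ∑_i i·e_i = 2A + 3B + 6C and (as integers) 2C + B = 2(∑_i e_i) − 2 + 2χ. Let e_L, o_L be natural numbers with A + B + C ≤ e_L + o_L − 1, χ ≤ 1 − e_L and e_L ≥ o_L. Then e_3 ≥ 2 + ∑_{j≥5} (j − 4)·e_j (as integers). -/
/-- If `e` vanishes at `0`, `1` and `2`, the only negative term of `∑ (j - 4) * e j` is the one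
at `j = 3`. -/
theorem Finsupp.sum_sub_four_mul (e : ℕ →₀ ℕ) (he0 : e 0 = 0) (he1 : e 1 = 0) (he2 : e 2 = 0) :
    ∑ j ∈ e.support, ((j : ℤ) - 4) * (e j : ℤ) =
      ∑ j ∈ e.support.filter (fun j => 5 ≤ j), ((j : ℤ) - 4) * (e j : ℤ) - (e 3 : ℤ) := by
  have h3 : (e 3 : ℤ) = ∑ j ∈ e.support, if j = 3 then (e j : ℤ) else 0 := by
    simp +contextual [Finset.sum_ite_eq', eq_comm]
  rw [h3, Finset.sum_filter, ← Finset.sum_sub_distrib]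
  refine Finset.sum_congr rfl fun j _ => ?_
  rcases lt_or_ge j 5 with hj | hj
  · interval_cases j <;> simp [he0, he1, he2]
  · simp [hj, show j ≠ 3 by lia]

/-- Inequality (5) of Section 4.3: with `A`, `B`, `C` the numbers of tetrahedra of
types 1, 2, 3 in a minimal triangulation, `e i` the number of `φ`-even edges of
degree `i` (all degrees are at least three), `χ` the Euler characteristic of the dual
normal surface, and `e_L`, `o_L` the numbers of `φ`-even and `φ`-odd edges of the
minimal layered triangulation, the stated hypotheses force
`e 3 ≥ 2 + ∑_{j ≥ 5} (j - 4)·e j`. -/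
theorem degree_three_even_edge_bound_lens (A B C : ℕ) (χ : ℤ) (e : ℕ →₀ ℕ)
    (eL oL : ℕ)
    (he0 : e 0 = 0) (he1 : e 1 = 0) (he2 : e 2 = 0)
    (hdeg : (e.sum fun i n => i * n) = 2 * A + 3 * B + 6 * C)
    (hchi : 2 * (C : ℤ) + (B : ℤ) = 2 * ((e.sum fun _ n => n : ℕ) : ℤ) - 2 + 2 * χ)
    (hT : (A : ℤ) + B + C ≤ (eL : ℤ) + oL - 1)
    (hχL : χ ≤ 1 - (eL : ℤ))
    (heo : oL ≤ eL) :
    ((e 3 : ℤ)) ≥ 2 + ∑ j ∈ e.support.filter (fun j => 5 ≤ j),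
      ((j : ℤ) - 4) * (e j : ℤ) := by
  have hS : ∑ j ∈ e.support, ((j : ℤ) - 4) * (e j : ℤ) =
      ((e.sum fun i n => i * n : ℕ) : ℤ) - 4 * ((e.sum fun _ n => n : ℕ) : ℤ) := by
    simp only [Finsupp.sum, Nat.cast_sum, Nat.cast_mul, Finset.mul_sum, sub_mul,
      Finset.sum_sub_distrib]
  rw [e.sum_sub_four_mul he0 he1 he2, hdeg] at hS
  push_cast at hS hchi
  lia
end

section
/- For all natural numbers s, t ≥ 1, E((s+2)(t+1) + 1, t+1) = s + t + 3 and E((s+1)(t+2) + 1, t+2) = s + t + 3. In particular, the conjectured (and, by the paper's Theorems 2 and 3, actual) complexity E(p,q) − 3 of the lens spaces L((s+2)(t+1)+1, t+1) and L((s+1)(t+2)+1, t+2) equals s + t. -/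
/-- `euclidSteps p q` is the number of steps the subtraction-based Euclidean algorithm
needs to transform the unordered pair `(p, q)` into `(1, 0)` (for coprime `p ≥ q`):
`E(p, 0) = 0` and `E(p, q) = 1 + E(max (p - q) q, min (p - q) q)` for `q ≥ 1`. -/
def euclidSteps : ℕ → ℕ → ℕ
  | _, 0 => 0
  | p, q + 1 =>
      1 + euclidSteps (max (p - (q + 1)) (q + 1)) (min (p - (q + 1)) (q + 1))
termination_by p q => p + 2 * q
decreasing_by
  simp only [Nat.max_def, Nat.min_def]
  split <;> omega


theorem euclidSteps_of_pos (p : ℕ) {q : ℕ} (hq : 1 ≤ q) :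
    euclidSteps p q = 1 + euclidSteps (max (p - q) q) (min (p - q) q) := by
  obtain ⟨q, rfl⟩ := Nat.exists_eq_add_of_le' hq
  rw [euclidSteps]

theorem euclidSteps_zero_right (p : ℕ) : euclidSteps p 0 = 0 := by
  rw [euclidSteps]

theorem euclidSteps_add_left {p q : ℕ} (hq : 1 ≤ q) (h : q ≤ p) :
    euclidSteps (p + q) q = 1 + euclidSteps p q := by
  rw [euclidSteps_of_pos _ hq, Nat.add_sub_cancel, max_eq_left h, min_eq_right h]

theorem euclidSteps_one_right {p : ℕ} (hp : 1 ≤ p) : euclidSteps p 1 = p := by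
  induction p, hp using Nat.le_induction with
  | base => simp [euclidSteps_of_pos 1 le_rfl, euclidSteps_zero_right]
  | succ p hp ih => rw [euclidSteps_add_left le_rfl hp, ih, add_comm]

theorem euclidSteps_mul_add_one {k q : ℕ} (hk : 1 ≤ k) (hq : 1 ≤ q) :
    euclidSteps (k * q + 1) q = k + q := by
  induction k, hk using Nat.le_induction with
  | base =>
    rw [euclidSteps_of_pos _ hq, one_mul, Nat.add_sub_cancel_left, max_eq_right hq,
      min_eq_left hq, euclidSteps_one_right hq]
  | succ k hk ih =>
    have h : q ≤ k * q + 1 := (Nat.le_mul_of_pos_left q hk).trans (Nat.le_succ _)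
    rw [show (k + 1) * q + 1 = k * q + 1 + q by ring, euclidSteps_add_left hq h, ih]
    ring

/-- For `s, t ≥ 1`, `E((s+2)(t+1) + 1, t+1) = s + t + 3` and
`E((s+1)(t+2) + 1, t+2) = s + t + 3`; in particular, the complexity `E(p, q) - 3`
of the lens spaces `L((s+2)(t+1)+1, t+1)` and `L((s+1)(t+2)+1, t+2)` equals
`s + t`. -/
theorem euclidSteps_two_families (s t : ℕ) (hs : 1 ≤ s) (ht : 1 ≤ t) :
    euclidSteps ((s + 2) * (t + 1) + 1) (t + 1) = s + t + 3 ∧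
    euclidSteps ((s + 1) * (t + 2) + 1) (t + 2) = s + t + 3 ∧
    euclidSteps ((s + 2) * (t + 1) + 1) (t + 1) - 3 = s + t ∧
    euclidSteps ((s + 1) * (t + 2) + 1) (t + 2) - 3 = s + t := by
  have h₁ := euclidSteps_mul_add_one (k := s + 2) (q := t + 1) (by omega) (by omega)
  have h₂ := euclidSteps_mul_add_one (k := s + 1) (q := t + 2) (by omega) (by omega)
  omega
end
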